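/- arXiv:2405.18314 — 7 statements merged into one kernel-verified Lean document; each statement's English description precedes it below -/
import Mathlib

section
/- Let n ∈ ℕ and for each i : Fin n let μ_i be an atomless Borel probability measure on ℝ; let μ = Measure.pi μ be the product measure on (Fin n → ℝ). Let p : MvPolynomial (Fin n) ℝ be a nonzero polynomial that is multilinear, i.e. has degree at most 1 in each variable. Then μ {x : Fin n → ℝ | MvPolynomial.eval x p = 0} = 0. -/
open MeasureTheory

/-- The zero set of a nonzero real polynomial is null for any product of σ-finite atomless
measures. -/
theorem MvPolynomial.measure_pi_zero_set (n : ℕ) (ν : Fin n → Measure ℝ)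
    [∀ i, SigmaFinite (ν i)] [∀ i, NullSingletonClass (ν i)] (p : MvPolynomial (Fin n) ℝ) (hp : p ≠ 0) :
    Measure.pi ν {x : Fin n → ℝ | MvPolynomial.eval x p = 0} = 0 := by
  induction n with
  | zero =>
    obtain ⟨c, rfl⟩ := MvPolynomial.C_surjective (Fin 0) p
    have hc : c ≠ 0 := by
      rintro rfl
      exact hp (map_zero _)
    simp [hc]
  | succ n ih =>
    have hq : MvPolynomial.finSuccEquiv ℝ n p ≠ 0 := by simpa using hp
    have h_lead := ih (fun j => ν j.succ) _ (Polynomial.leadingCoeff_ne_zero.mpr hq)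
    have h_meas : MeasurableSet {x : Fin (n + 1) → ℝ | MvPolynomial.eval x p = 0} :=
      (isClosed_singleton.preimage (MvPolynomial.continuous_eval p)).measurableSet
    have h_symm := (measurePreserving_piFinSuccAbove ν 0).symm
    rw [← h_symm.measure_preimage h_meas.nullMeasurableSet,
      Measure.prod_apply_symm (h_symm.measurable h_meas), ← lintegral_zero]
    refine lintegral_congr_ae ?_
    filter_upwards [measure_eq_zero_iff_ae_notMem.mp h_lead] with s hs
    set r := (MvPolynomial.finSuccEquiv ℝ n p).map (MvPolynomial.eval s) with hr
    have h_ne : r ≠ 0 := fun h => hs <| by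
      simpa [r, Polynomial.coeff_map] using
        congrArg (Polynomial.coeff · (MvPolynomial.finSuccEquiv ℝ n p).natDegree) h
    refine measure_mono_null (fun y hy => ?_)
      ((r.rootSet_finite ℝ).countable.measure_zero _)
    rw [Polynomial.mem_rootSet]
    refine ⟨h_ne, ?_⟩
    rw [Polynomial.coe_aeval_eq_eval, hr, ← MvPolynomial.eval_eq_eval_mv_eval']
    simpa [MeasurableEquiv.piFinSuccAbove, Fin.insertNthEquiv] using hy

/-- If `p` is a nonzero multilinear polynomial (degree at most 1 in each variable) in `n`
variables over `ℝ`, and `μ` is a product of atomless Borel probability measures on `ℝ`,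
then the zero set of `p` is `μ`-null. -/
theorem multilinear_polynomial_zero_set_null (n : ℕ)
    (μi : Fin n → Measure ℝ)
    [∀ i, IsProbabilityMeasure (μi i)]
    (hatomless : ∀ i, ∀ x : ℝ, μi i {x} = 0)
    (p : MvPolynomial (Fin n) ℝ) (hp : p ≠ 0)
    (hml : ∀ m ∈ p.support, ∀ i : Fin n, m i ≤ 1) :
    Measure.pi μi {x : Fin n → ℝ | MvPolynomial.eval x p = 0} = 0 := by
  have (i : Fin n) : NullSingletonClass (μi i) := ⟨hatomless i⟩
  exact MvPolynomial.measure_pi_zero_set n μi p hp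
end

section
/- Let d ≥ 1 and let E : Fin d → Fin d → Prop be a decidable acyclic edge relation on Fin d with finite edge set 𝐄 = {(i, j) | E i j}. For each edge e ∈ 𝐄 let μ_e be an atomless Borel probability measure on ℝ, and let μ be the product measure on (𝐄 → ℝ) (so the edge weights are independent with atomless laws). For a weight assignment w : 𝐄 → ℝ define the matrix B_w : Matrix (Fin d) (Fin d) ℝ by B_w i j = w (i, j) if E i j and B_w i j = 0 otherwise. Then for every pair (i, j) with Relation.TransGen E i j, the total causal effect is almost surely nonzero: μ {w | (∑_{k=1}^{d−1} (B_w)^k) i j = 0} = 0. -/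
open MeasureTheory

/-- A nonzero real polynomial in finitely many variables is almost everywhere nonzero with respect
to any product of atomless `σ`-finite measures. -/
theorem MvPolynomial.ae_eval_ne_zero {σ : Type*} [Fintype σ] (μ : σ → Measure ℝ)
    [∀ s, SigmaFinite (μ s)] [∀ s, NullSingletonClass (μ s)] {p : MvPolynomial σ ℝ} (hp : p ≠ 0) :
    ∀ᵐ w ∂Measure.pi μ, MvPolynomial.eval w p ≠ 0 := by
  have measurableSet_ne {τ : Type _} [Fintype τ] (q : MvPolynomial τ ℝ) :
      MeasurableSet {w : τ → ℝ | MvPolynomial.eval w q ≠ 0} :=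
    (isOpen_ne_fun (MvPolynomial.continuous_eval q) continuous_const).measurableSet
  revert μ p
  refine Fintype.induction_empty_option (P := fun σ _ => ∀ (μ : σ → Measure ℝ)
    [∀ s, SigmaFinite (μ s)] [∀ s, NullSingletonClass (μ s)] {p : MvPolynomial σ ℝ}, p ≠ 0 →
    ∀ᵐ w ∂Measure.pi μ, MvPolynomial.eval w p ≠ 0) ?_ ?_ ?_ σ
  · intro α β _ e ih μ _ _ p hp
    let := Fintype.ofEquiv β e.symm
    rw [← Measure.pi_map_piCongrLeft e μ,
      ae_map_iff (MeasurableEquiv.measurable _).aemeasurable (measurableSet_ne p)]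
    have hq : MvPolynomial.rename e.symm p ≠ 0 := by
      rwa [Ne, map_eq_zero_iff _ (MvPolynomial.rename_injective _ e.symm.injective)]
    filter_upwards [ih (fun a => μ (e a)) hq] with w hw
    rw [MvPolynomial.eval_rename] at hw
    convert! hw using 3
    ext b
    obtain ⟨a, rfl⟩ := e.surjective b
    simp [MeasurableEquiv.coe_piCongrLeft]
  · intro μ _ _ p hp
    refine Filter.Eventually.of_forall fun w hw => hp ?_
    rw [MvPolynomial.eq_C_of_isEmpty p] at hw ⊢
    simpa using hw
  · intro α _ ih μ _ _ p hp
    rw [← Measure.pi_map_piOptionEquivProd μ,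
      ae_map_iff (MeasurableEquiv.measurable _).aemeasurable (measurableSet_ne p),
      Measure.ae_prod_iff_ae_ae
        (p := fun x => MvPolynomial.eval ((MeasurableEquiv.piOptionEquivProd _).symm x) p ≠ 0)
        ((MeasurableEquiv.measurable _) (measurableSet_ne p))]
    set q := MvPolynomial.optionEquivLeft ℝ α p with hq
    have hq0 : q ≠ 0 := by simpa [hq] using hp
    filter_upwards [ih (fun a => μ (some a)) (Polynomial.leadingCoeff_ne_zero.mpr hq0)] with w hw
    have hmap : q.map (MvPolynomial.eval w) ≠ 0 := fun h => hw <| by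
      simpa using congrArg (Polynomial.coeff · q.natDegree) h
    filter_upwards [(Polynomial.finite_setOfPred_isRoot hmap).countable.ae_notMem (μ none)] with y hy
    intro h
    apply hy
    change Polynomial.eval y _ = 0
    rw [hq, ← MvPolynomial.optionEquivLeft_elim_eval, ← h]
    congr 2
    ext x
    cases x <;> rfl

open Classical in
/-- In a finite acyclic relation, vertices joined by a path are joined by a path no longer than the
number of ancestors of the endpoint, so the corresponding power of any nonnegative weight matrix
positive on the edges has a positive entry. -/
theorem Matrix.exists_pow_apply_pos_of_transGen {V : Type*} [Fintype V] [DecidableEq V]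
    {E : V → V → Prop}
    (hacyc : ∀ i, ¬ Relation.TransGen E i i) {A : Matrix V V ℝ} (hA : ∀ a b, 0 ≤ A a b)
    (hE : ∀ a b, E a b → 0 < A a b) {i j : V} (hij : Relation.TransGen E i j) :
    ∃ k, 1 ≤ k ∧ k ≤ Finset.card {u | Relation.TransGen E u j} ∧ 0 < (A ^ k) i j := by
  induction hij with
  | @single b h =>
    refine ⟨1, le_rfl, Finset.card_pos.mpr ⟨i, by simpa using .single h⟩, by simpa using hE _ _ h⟩
  | @tail b c _ hbc ih =>
    obtain ⟨k, hk, hkb, hpos⟩ := ih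
    refine ⟨k + 1, by lia, (Nat.succ_le_succ hkb).trans (Finset.card_lt_card ?_), ?_⟩
    · refine Finset.ssubset_iff_of_subset (fun u hu => ?_) |>.mpr
        ⟨b, by simpa using .single hbc, by simpa using hacyc b⟩
      simp only [Finset.mem_filter_univ] at hu ⊢
      exact hu.tail hbc
    · rw [pow_succ, Matrix.mul_apply]
      exact Finset.sum_pos' (fun x _ => mul_nonneg (Matrix.pow_apply_nonneg hA k i x) (hA x c))
        ⟨b, Finset.mem_univ b, mul_pos hpos (hE b c hbc)⟩

/-- For an acyclic decidable edge relation `E` on `Fin d` (`d ≥ 1`), with edge weights drawn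
independently from atomless Borel probability measures on `ℝ`, the total causal effect
`(∑_{k=1}^{d-1} (B_w)^k) i j` of any pair `(i, j)` connected by a directed path is almost
surely nonzero. -/
theorem total_causal_effect_as_nonzero (d : ℕ) (hd : 1 ≤ d)
    (E : Fin d → Fin d → Prop) [DecidableRel E]
    (hacyc : ∀ i, ¬ Relation.TransGen E i i)
    (μe : {e : Fin d × Fin d // E e.1 e.2} → Measure ℝ)
    [∀ e, IsProbabilityMeasure (μe e)]
    (hatomless : ∀ e, ∀ x : ℝ, μe e {x} = 0)
    (i j : Fin d) (hij : Relation.TransGen E i j) :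
    Measure.pi μe
      {w : {e : Fin d × Fin d // E e.1 e.2} → ℝ |
        (∑ k ∈ Finset.Icc 1 (d - 1),
            (Matrix.of (fun a b : Fin d => if h : E a b then w ⟨(a, b), h⟩ else 0)) ^ k) i j
          = 0} = 0 := by
  classical
  have (e : _) : NullSingletonClass (μe e) := ⟨hatomless e⟩
  let M : Matrix (Fin d) (Fin d) (MvPolynomial {e : Fin d × Fin d // E e.1 e.2} ℝ) :=
    Matrix.of fun a b => if h : E a b then MvPolynomial.X ⟨(a, b), h⟩ else 0
  have eval_sum (w : {e : Fin d × Fin d // E e.1 e.2} → ℝ) :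
      MvPolynomial.eval w ((∑ k ∈ Finset.Icc 1 (d - 1), M ^ k) i j) =
        (∑ k ∈ Finset.Icc 1 (d - 1),
          (Matrix.of (fun a b : Fin d => if h : E a b then w ⟨(a, b), h⟩ else 0)) ^ k) i j := by
    have hM : (MvPolynomial.eval w).mapMatrix M =
        Matrix.of (fun a b : Fin d => if h : E a b then w ⟨(a, b), h⟩ else 0) := by
      ext a b
      by_cases h : E a b <;> simp [M, h]
    simp only [← hM, ← map_pow, ← map_sum]
    rfl
  have hne : (∑ k ∈ Finset.Icc 1 (d - 1), M ^ k) i j ≠ 0 := by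
    intro h0
    have h1 := eval_sum 1
    rw [h0, map_zero] at h1
    set A : Matrix (Fin d) (Fin d) ℝ := Matrix.of fun a b =>
      if h : E a b then (1 : {e : Fin d × Fin d // E e.1 e.2} → ℝ) ⟨(a, b), h⟩ else 0 with hA
    have hA0 (a b) : 0 ≤ A a b := by by_cases h : E a b <;> simp [hA, h]
    obtain ⟨k, hk1, hk, hpos⟩ := Matrix.exists_pow_apply_pos_of_transGen hacyc hA0
      (fun a b h => by simp [hA, h]) hij
    have hlt : Finset.card {u | Relation.TransGen E u j} < d := by
      simpa using Finset.card_lt_univ_of_notMem (x := j)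
        (s := {u | Relation.TransGen E u j}) (by simpa using hacyc j)
    refine (Finset.sum_pos' (fun n _ => Matrix.pow_apply_nonneg hA0 n i j)
      ⟨k, Finset.mem_Icc.mpr ⟨hk1, ?_⟩, hpos⟩).ne (h1.trans (Matrix.sum_apply ..))
    exact Nat.le_sub_one_of_lt (lt_of_le_of_lt hk hlt)
  have hae := MvPolynomial.ae_eval_ne_zero μe hne
  simp only [ne_eq, eval_sum] at hae
  simpa [ae_iff] using hae
end

section
/- Let d ≥ 1, let E : Fin d → Fin d → Prop be an acyclic edge relation on Fin d, let ε > 0 and c ≥ 0, and let D : Fin d → Fin d → ℝ be nonnegative and satisfy, for all i ≠ j: D i j > ε if Relation.TransGen E i j, and D i j = 0 if ¬Relation.TransGen E i j. Let S be the score with parameters ε, c, D and intervened set I = Finset.univ, and let π_opt be any permutation of Fin d attaining the maximum of S over all permutations of Fin d. Then D_top(E, π_opt) = 0, i.e. there is no pair (i, j) with E i j and π_opt i > π_opt j. -/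
/-- The Intersort score of a permutation `π`: the sum over ordered pairs `(i, j)` with
`i ∈ I`, `j ≠ i` and `π i < π j` of `(D i j - ε) + c * d * 𝟙[ε < D i j]`. -/
noncomputable def score {d : ℕ} (ε c : ℝ) (I : Finset (Fin d)) (D : Fin d → Fin d → ℝ)
    (π : Equiv.Perm (Fin d)) : ℝ :=
  ∑ ij ∈ Finset.univ.filter
      (fun ij : Fin d × Fin d => ij.1 ∈ I ∧ ij.2 ≠ ij.1 ∧ π ij.1 < π ij.2),
    ((D ij.1 ij.2 - ε) + c * d * (if ε < D ij.1 ij.2 then 1 else 0))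

theorem exists_equiv_fin_strictMono {α : Type*} [Fintype α] [PartialOrder α] {n : ℕ}
    (h : Fintype.card α = n) : ∃ τ : α ≃ Fin n, StrictMono τ := by
  let _ : Fintype (LinearExtension α) := ‹Fintype α›
  let e : Fin n ≃o LinearExtension α := Fintype.orderIsoFinOfCardEq (LinearExtension α) h
  have hinj : Function.Injective (toLinearExtension : α →o LinearExtension α) :=
    fun _ _ hxy => hxy
  refine ⟨(Equiv.refl α : α ≃ LinearExtension α).trans e.symm.toEquiv, ?_⟩
  exact e.symm.strictMono.comp (toLinearExtension.monotone.strictMono_of_injective hinj)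

/-- A finite acyclic relation admits a topological order. -/
theorem exists_topological_order {α : Type*} [Fintype α] {n : ℕ} (h : Fintype.card α = n)
    (E : α → α → Prop) (hacyc : ∀ i, ¬ Relation.TransGen E i i) :
    ∃ τ : α ≃ Fin n, ∀ i j, Relation.TransGen E i j → τ i < τ j := by
  have : IsStrictOrder α (Relation.TransGen E) :=
    { irrefl := hacyc, trans := fun _ _ _ => Relation.TransGen.trans }
  let _ : PartialOrder α := partialOrderOfSO (Relation.TransGen E)
  obtain ⟨τ, hτ⟩ := exists_equiv_fin_strictMono h
  exact ⟨τ, fun i j hij => hτ hij⟩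

/-- Twice a sum over the pairs ordered by `π`, as a sum over all off-diagonal pairs. -/
theorem two_mul_sum_ordered_pairs {α β : Type*} [Fintype α] [DecidableEq α] [LinearOrder β]
    (π : α ≃ β) (w : α → α → ℝ) :
    2 * ∑ ij : α × α with ij.2 ≠ ij.1 ∧ π ij.1 < π ij.2, w ij.1 ij.2 =
      ∑ ij : α × α with ij.1 ≠ ij.2, if π ij.1 < π ij.2 then w ij.1 ij.2 else w ij.2 ij.1 := by
  have hswap : ∑ ij : α × α with ij.2 ≠ ij.1 ∧ π ij.1 < π ij.2, w ij.1 ij.2 =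
      ∑ ij : α × α with ij.2 ≠ ij.1 ∧ π ij.2 < π ij.1, w ij.2 ij.1 := by
    simp only [Finset.sum_filter]
    rw [← Equiv.sum_comp (Equiv.prodComm α α)]
    refine Finset.sum_congr rfl fun ij _ => ?_
    simp only [Equiv.prodComm_apply, Prod.fst_swap, Prod.snd_swap, ne_comm]
    congr
  rw [two_mul]
  nth_rewrite 2 [hswap]
  simp only [Finset.sum_filter]
  rw [← Finset.sum_add_distrib]
  refine Finset.sum_congr rfl fun ij _ => ?_
  rcases lt_trichotomy (π ij.1) (π ij.2) with h | h | h
  · have hne : ij.1 ≠ ij.2 := fun e => by simp [e] at h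
    simp [h, h.le, hne, hne.symm]
  · have he := π.injective h
    simp [he]
  · have hne : ij.1 ≠ ij.2 := fun e => by simp [e] at h
    simp [h, hne, hne.symm, h.not_gt]

/-- If all variables are intervened on (`I = univ`) and the distance matrix `D` is
`ε`-interventionally faithful for the acyclic relation `E`, then any maximizer `π_opt`
of the score has zero top order divergence: no edge `(i, j)` has `π_opt i > π_opt j`. -/
theorem score_maximizer_dtop_zero (d : ℕ) (hd : 1 ≤ d)
    (E : Fin d → Fin d → Prop) [DecidableRel E]
    (hacyc : ∀ i, ¬ Relation.TransGen E i i)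
    (ε c : ℝ) (hε : 0 < ε) (hc : 0 ≤ c)
    (D : Fin d → Fin d → ℝ) (hD0 : ∀ i j, 0 ≤ D i j)
    (hfaith : ∀ i j : Fin d, i ≠ j →
      (Relation.TransGen E i j → ε < D i j) ∧ (¬ Relation.TransGen E i j → D i j = 0))
    (πopt : Equiv.Perm (Fin d))
    (hopt : ∀ π : Equiv.Perm (Fin d),
      score ε c Finset.univ D π ≤ score ε c Finset.univ D πopt) :
    (Finset.univ.filter
      (fun ij : Fin d × Fin d => E ij.1 ij.2 ∧ πopt ij.2 < πopt ij.1)).card = 0 := by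
  rw [Finset.card_eq_zero, Finset.filter_eq_empty_iff]
  rintro ⟨a, b⟩ - ⟨hab, hba⟩
  obtain ⟨τ, hτ⟩ := exists_topological_order (Fintype.card_fin d) E hacyc
  set w : Fin d → Fin d → ℝ := fun i j =>
    (D i j - ε) + c * d * (if ε < D i j then 1 else 0) with hw
  have hscore : ∀ π : Equiv.Perm (Fin d), 2 * score ε c Finset.univ D π =
      ∑ ij : Fin d × Fin d with ij.1 ≠ ij.2,
        if π ij.1 < π ij.2 then w ij.1 ij.2 else w ij.2 ij.1 := by
    intro π
    rw [← two_mul_sum_ordered_pairs π w]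
    simp [score, hw]
  have hcd : 0 ≤ c * d := mul_nonneg hc (Nat.cast_nonneg d)
  have hw_ge : ∀ i j, -ε ≤ w i j := by
    intro i j
    have := hD0 i j
    simp only [hw]
    split_ifs <;> linarith
  have hw_pos : ∀ i j, Relation.TransGen E i j → -ε < w i j := by
    intro i j hij
    have hne : i ≠ j := by rintro rfl; exact hacyc i hij
    have := (hfaith i j hne).1 hij
    simp only [hw, if_pos this]
    linarith
  have hw_eq : ∀ i j, i ≠ j → τ i < τ j → w j i = -ε := by
    intro i j hne hij
    have h0 := (hfaith j i hne.symm).2 fun h => lt_asymm hij (hτ j i h)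
    simp [hw, h0, hε.not_gt]
  have hne : a ≠ b := by rintro rfl; exact lt_irrefl _ hba
  have hlt : ∑ ij : Fin d × Fin d with ij.1 ≠ ij.2,
        (if πopt ij.1 < πopt ij.2 then w ij.1 ij.2 else w ij.2 ij.1) <
      ∑ ij : Fin d × Fin d with ij.1 ≠ ij.2,
        (if τ ij.1 < τ ij.2 then w ij.1 ij.2 else w ij.2 ij.1) := by
    refine Finset.sum_lt_sum ?_ ⟨(a, b), by simpa using hne, ?_⟩
    · rintro ⟨i, j⟩ hij
      replace hij : i ≠ j := by simpa using hij
      dsimp only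
      rcases lt_or_gt_of_ne (τ.injective.ne hij) with h | h
      · rw [if_pos h]
        split_ifs
        · exact le_rfl
        · exact (hw_eq i j hij h).trans_le (hw_ge i j)
      · rw [if_neg h.not_gt]
        split_ifs
        · exact (hw_eq j i hij.symm h).trans_le (hw_ge j i)
        · exact le_rfl
    · have hE : Relation.TransGen E a b := .single hab
      have hτab := hτ a b hE
      dsimp only at hba ⊢
      rw [if_pos hτab, if_neg hba.not_gt, hw_eq a b hne hτab]
      exact hw_pos a b hE
  have hmax := hopt τ
  rw [← hscore, ← hscore] at hlt
  linarith
end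

section
/- Let d ≥ 1, let E : Fin d → Fin d → Prop be an acyclic edge relation on Fin d, let ε > 0, and let D : Fin d → Fin d → ℝ be nonnegative and satisfy, for all i ≠ j: D i j > ε if Relation.TransGen E i j, and D i j = 0 if ¬Relation.TransGen E i j. Let S be the score with parameters ε, c = 0, D and intervened set I = Finset.univ. Then for every causal order π* of E: S(π*) = (∑ over all ordered pairs (i, j) with i ≠ j of D i j) − (d·(d−1)/2)·ε. -/
/-- An injective ranking puts exactly half of the ordered pairs of distinct elements in
increasing order. -/
theorem two_mul_card_filter_lt_add_card {α β : Type*} [Fintype α] [LinearOrder β]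
    {f : α → β} (hf : Function.Injective f) :
    2 * (Finset.univ.filter (fun p : α × α => f p.1 < f p.2)).card + Fintype.card α =
      Fintype.card α * Fintype.card α := by
  classical
  have hswap : (Finset.univ.filter (fun p : α × α => f p.2 < f p.1)).card =
      (Finset.univ.filter (fun p : α × α => f p.1 < f p.2)).card :=
    Finset.card_equiv (Equiv.prodComm α α) (by simp)
  have hsplit : (Finset.univ : Finset α).offDiag =
      Finset.univ.filter (fun p : α × α => f p.1 < f p.2) ∪
        Finset.univ.filter (fun p : α × α => f p.2 < f p.1) := by
    ext p
    simp [← lt_or_lt_iff_ne, ← hf.ne_iff]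
  have hdisj : Disjoint (Finset.univ.filter (fun p : α × α => f p.1 < f p.2))
      (Finset.univ.filter (fun p : α × α => f p.2 < f p.1)) :=
    Finset.disjoint_filter.2 fun _ _ h => h.not_gt
  have hcard := congrArg Finset.card hsplit
  rw [Finset.card_union_of_disjoint hdisj, hswap, Finset.offDiag_card, Finset.card_univ] at hcard
  have hle := Nat.le_mul_self (Fintype.card α)
  omega

/-- With `I = univ`, `c = 0` and an `ε`-interventionally faithful distance matrix `D`
for the acyclic relation `E`, every causal order `π*` has score
`(∑_{i ≠ j} D i j) - (d (d - 1) / 2) ε`. -/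
theorem score_of_causal_order (d : ℕ) (hd : 1 ≤ d)
    (E : Fin d → Fin d → Prop) [DecidableRel E]
    (hacyc : ∀ i, ¬ Relation.TransGen E i i)
    (ε : ℝ) (hε : 0 < ε)
    (D : Fin d → Fin d → ℝ) (hD0 : ∀ i j, 0 ≤ D i j)
    (hfaith : ∀ i j : Fin d, i ≠ j →
      (Relation.TransGen E i j → ε < D i j) ∧ (¬ Relation.TransGen E i j → D i j = 0))
    (πstar : Equiv.Perm (Fin d))
    (hπstar : ∀ i j, Relation.TransGen E i j → πstar i < πstar j) :
    score ε 0 Finset.univ D πstar =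
      (∑ ij ∈ Finset.univ.filter (fun ij : Fin d × Fin d => ij.1 ≠ ij.2), D ij.1 ij.2)
        - ((d : ℝ) * ((d : ℝ) - 1) / 2) * ε := by
  have hfilter : Finset.univ.filter (fun ij : Fin d × Fin d =>
      ij.1 ∈ (Finset.univ : Finset (Fin d)) ∧ ij.2 ≠ ij.1 ∧ πstar ij.1 < πstar ij.2) =
      Finset.univ.filter (fun ij : Fin d × Fin d => πstar ij.1 < πstar ij.2) := by
    refine Finset.filter_congr fun ij _ => ⟨fun h => h.2.2, fun h => ⟨Finset.mem_univ _, ?_, h⟩⟩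
    rintro heq
    exact h.ne (congrArg πstar heq.symm)
  have hsum : ∑ ij ∈ Finset.univ.filter (fun ij : Fin d × Fin d => πstar ij.1 < πstar ij.2),
      D ij.1 ij.2 =
      ∑ ij ∈ Finset.univ.filter (fun ij : Fin d × Fin d => ij.1 ≠ ij.2), D ij.1 ij.2 := by
    refine Finset.sum_subset (fun ij h => ?_) fun ij hne hlt => ?_
    · simp only [Finset.mem_filter, Finset.mem_univ, true_and] at h ⊢
      exact fun heq => h.ne (congrArg πstar heq)
    · simp only [Finset.mem_filter, Finset.mem_univ, true_and] at hne hlt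
      exact (hfaith _ _ hne).2 fun hpath => hlt (hπstar _ _ hpath)
  have hcard := two_mul_card_filter_lt_add_card πstar.injective
  rw [Fintype.card_fin] at hcard
  have hcard' := congrArg (Nat.cast : ℕ → ℝ) hcard
  push_cast at hcard'
  simp only [score, zero_mul, add_zero]
  rw [hfilter, Finset.sum_sub_distrib, hsum, Finset.sum_const, nsmul_eq_mul]
  linear_combination (-ε / 2) * hcard'
end

section
/- Let d ≥ 1, let E : Fin d → Fin d → Prop be an acyclic edge relation on Fin d, let ε > 0, and let D : Fin d → Fin d → ℝ be nonnegative and satisfy, for all i ≠ j: D i j > ε if Relation.TransGen E i j, and D i j = 0 if ¬Relation.TransGen E i j. Let S be the score with parameters ε, c = 0, D and intervened set I = Finset.univ. Then for every causal order π* of E and every permutation π of Fin d: S(π*) − S(π) = ∑ over ordered pairs (i, j) with π i > π j of D i j. In particular S(π*) ≥ S(π) for every permutation π. -/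
/-- The total of a constant over the pairs a permutation puts in increasing order does not depend
on the permutation. -/
lemma sum_const_filter_perm_lt {d : ℕ} (ε : ℝ) (π : Equiv.Perm (Fin d)) :
    ∑ _ij : Fin d × Fin d with π _ij.1 < π _ij.2, ε =
      ∑ _ij : Fin d × Fin d with _ij.1 < _ij.2, ε :=
  Finset.sum_equiv (π.prodCongr π) (by simp) (by simp)

lemma score_zero_univ {d : ℕ} (ε : ℝ) (D : Fin d → Fin d → ℝ) (π : Equiv.Perm (Fin d)) :
    score ε 0 Finset.univ D π =
      ∑ ij : Fin d × Fin d with π ij.1 < π ij.2, D ij.1 ij.2 -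
        ∑ _ij : Fin d × Fin d with _ij.1 < _ij.2, ε := by
  rw [← sum_const_filter_perm_lt ε π, ← Finset.sum_sub_distrib, score]
  refine Finset.sum_congr (Finset.filter_congr fun ij _ => ?_) fun ij _ => by simp
  refine ⟨fun h => h.2.2, fun h => ⟨Finset.mem_univ _, fun he => ?_, h⟩⟩
  rw [he] at h
  exact lt_irrefl _ h

/-- If `D` vanishes off the diagonal at all pairs not increasing under `σ`, then the sum of `D`
over the pairs increasing under `σ` splits along any other permutation. -/
lemma sum_filter_perm_lt_eq_add {d : ℕ} (D : Fin d → Fin d → ℝ) (σ π : Equiv.Perm (Fin d))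
    (hD : ∀ i j, i ≠ j → ¬ σ i < σ j → D i j = 0) :
    ∑ ij : Fin d × Fin d with σ ij.1 < σ ij.2, D ij.1 ij.2 =
      ∑ ij : Fin d × Fin d with π ij.1 < π ij.2, D ij.1 ij.2 +
        ∑ ij : Fin d × Fin d with π ij.2 < π ij.1, D ij.1 ij.2 := by
  simp only [Finset.sum_filter]
  rw [← Finset.sum_add_distrib]
  refine Finset.sum_congr rfl fun ⟨i, j⟩ _ => ?_
  rcases eq_or_ne i j with rfl | hij
  · simp
  · have hσ : (if σ i < σ j then D i j else 0) = D i j :=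
      ite_eq_left_iff.2 fun h => (hD i j hij h).symm
    rcases lt_or_gt_of_ne (π.injective.ne hij) with h | h <;> simp [hσ, h, h.not_gt]

/-- With `I = univ`, `c = 0` and an `ε`-interventionally faithful distance matrix `D`
for the acyclic relation `E`, for any causal order `π*` and any permutation `π`, the score
gap is `S(π*) - S(π) = ∑_{π i > π j} D i j`; in particular `π*` maximizes the score. -/
theorem score_gap_of_causal_order (d : ℕ) (hd : 1 ≤ d)
    (E : Fin d → Fin d → Prop) [DecidableRel E]
    (hacyc : ∀ i, ¬ Relation.TransGen E i i)
    (ε : ℝ) (hε : 0 < ε)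
    (D : Fin d → Fin d → ℝ) (hD0 : ∀ i j, 0 ≤ D i j)
    (hfaith : ∀ i j : Fin d, i ≠ j →
      (Relation.TransGen E i j → ε < D i j) ∧ (¬ Relation.TransGen E i j → D i j = 0))
    (πstar : Equiv.Perm (Fin d))
    (hπstar : ∀ i j, Relation.TransGen E i j → πstar i < πstar j) :
    (∀ π : Equiv.Perm (Fin d),
      score ε 0 Finset.univ D πstar - score ε 0 Finset.univ D π =
        ∑ ij ∈ Finset.univ.filter (fun ij : Fin d × Fin d => π ij.2 < π ij.1),
          D ij.1 ij.2) ∧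
    (∀ π : Equiv.Perm (Fin d),
      score ε 0 Finset.univ D π ≤ score ε 0 Finset.univ D πstar) := by
  have hgap (π : Equiv.Perm (Fin d)) :
      score ε 0 Finset.univ D πstar - score ε 0 Finset.univ D π =
        ∑ ij ∈ Finset.univ.filter (fun ij : Fin d × Fin d => π ij.2 < π ij.1),
          D ij.1 ij.2 := by
    rw [score_zero_univ, score_zero_univ, sum_filter_perm_lt_eq_add D πstar π
      fun i j hij h => (hfaith i j hij).2 (mt (hπstar i j) h)]
    ring
  refine ⟨hgap, fun π => ?_⟩
  rw [← sub_nonneg, hgap π]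
  exact Finset.sum_nonneg fun ij _ => hD0 ij.1 ij.2
end

section
/- Fix real numbers p and c with 0 < p < 1 and c > 0. For d : ℕ with d ≥ 1, define a_d = ((1 − p)^2 / p) * (1 − (1 − p * c / d) * (1 − (1 − p * c / d)^d) / (c * p)). Then the sequence (a_d) converges as d → ∞, and its limit is ((1 − p)^2 / p) * (1 − (1 − Real.exp (−c * p)) / (c * p)). Consequently, if the expected number of edges per variable is held constant (edge probability p_e = c/d), the per-variable upper bound on the expected top order divergence from the Erdős–Rényi theorem tends to ((1 − p)^2 / p) * (1 − (1 − exp(−c p)) / (c p)). -/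
/-- As `d → ∞` with edge probability `p_e = c / d` (constant expected number of edges per
variable), the per-variable Erdős–Rényi upper bound on the expected top order divergence
`a_d = ((1 - p)^2 / p) * (1 - (1 - p c / d)(1 - (1 - p c / d)^d)/(c p))` converges to
`((1 - p)^2 / p) * (1 - (1 - exp (-c p)) / (c p))`. -/
theorem erdos_renyi_bound_limit (p c : ℝ) (hp0 : 0 < p) (hp1 : p < 1) (hc : 0 < c) :
    Filter.Tendsto
      (fun d : ℕ =>
        ((1 - p) ^ 2 / p) *
          (1 - (1 - p * c / d) * (1 - (1 - p * c / d) ^ d) / (c * p)))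
      Filter.atTop
      (nhds (((1 - p) ^ 2 / p) * (1 - (1 - Real.exp (-c * p)) / (c * p)))) := by
  have base : Filter.Tendsto (fun d : ℕ => 1 - p * c / d) Filter.atTop (nhds 1) := by
    simpa using (tendsto_const_div_atTop_nhds_zero_nat (p * c)).const_sub 1
  have power : Filter.Tendsto (fun d : ℕ => (1 - p * c / d) ^ d) Filter.atTop
      (nhds (Real.exp (-c * p))) := by
    convert Real.tendsto_one_add_div_pow_exp (-c * p) using 3
    ring
  simpa only [one_mul] using
    (((base.mul (power.const_sub 1)).div_const (c * p)).const_sub 1).const_mul ((1 - p) ^ 2 / p)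
end

section
/- Let V be a type, let E : V → V → Prop be a relation, and let S : Set V. Define the projected edge relation E' : V → V → Prop by: E' a b iff a ∈ S, b ∈ S, and there exist n ≥ 1 and a finite sequence a = v₀, v₁, …, v_n = b with E v_l v_{l+1} for all 0 ≤ l < n and v_l ∉ S for all 0 < l < n. Then for all a, b with a ∈ S and b ∈ S: Relation.TransGen E a b ↔ Relation.TransGen E' a b. In other words, ancestral (directed-path) relationships among the observed variables S are preserved by the latent projection. -/
/-- There is a nonempty `E`-path from `a` to `b` whose intermediate vertices lie outside `S`. -/
def HasPathAvoiding {V : Type*} (E : V → V → Prop) (S : Set V) (a b : V) : Prop :=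
  ∃ (n : ℕ) (v : ℕ → V), 1 ≤ n ∧ v 0 = a ∧ v n = b ∧
    (∀ l < n, E (v l) (v (l + 1))) ∧ (∀ l, 0 < l → l < n → v l ∉ S)

namespace HasPathAvoiding

variable {V : Type*} {E : V → V → Prop} {S : Set V} {a b c : V}

theorem single (h : E a b) : HasPathAvoiding E S a b := by
  refine ⟨1, fun l => if l = 0 then a else b, le_rfl, by simp, by simp, ?_, ?_⟩
  · intro l hl
    obtain rfl : l = 0 := by omega
    simpa using h
  · intro l h0 h1
    omega

theorem tail (hab : HasPathAvoiding E S a b) (hb : b ∉ S) (hbc : E b c) :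
    HasPathAvoiding E S a c := by
  obtain ⟨n, v, -, h0, hn, hE, hS⟩ := hab
  refine ⟨n + 1, fun l => if l ≤ n then v l else c, by omega, by simpa using h0, by simp, ?_, ?_⟩
  · intro l hl
    rcases Nat.lt_succ_iff_lt_or_eq.mp hl with h | rfl
    · simpa [h.le, Nat.succ_le_of_lt h] using hE l h
    · simpa [hn] using hbc
  · intro l hl0 hl
    rcases Nat.lt_succ_iff_lt_or_eq.mp hl with h | rfl
    · simpa [h.le] using hS l hl0 h
    · simpa [hn] using hb

theorem transGen (h : HasPathAvoiding E S a b) : Relation.TransGen E a b := by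
  obtain ⟨n, v, hn, rfl, rfl, hE, -⟩ := h
  induction n, hn using Nat.le_induction with
  | base => exact .single (hE 0 one_pos)
  | succ n _ ih => exact .tail (ih fun l hl => hE l (by omega)) (hE n (by omega))

/-- Every path starting in `S` splits at its last vertex in `S` before the endpoint. -/
theorem exists_of_transGen {E' : V → V → Prop}
    (hE' : ∀ x ∈ S, ∀ y ∈ S, HasPathAvoiding E S x y → E' x y) (ha : a ∈ S)
    (h : Relation.TransGen E a b) :
    ∃ s ∈ S, Relation.ReflTransGen E' a s ∧ HasPathAvoiding E S s b := by
  induction h with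
  | single h => exact ⟨a, ha, .refl, .single h⟩
  | @tail x y _ hxy ih =>
    obtain ⟨s, hs, has, hsx⟩ := ih
    by_cases hx : x ∈ S
    · exact ⟨x, hx, has.tail (hE' s hs x hx hsx), .single hxy⟩
    · exact ⟨s, hs, has, hsx.tail hx hxy⟩

end HasPathAvoiding

/-- Ancestral (directed-path) relationships among observed variables are preserved by the
latent projection: if `E'` is the projected edge relation of `E` onto the observed set `S`
(an `E'`-edge from `a` to `b` exists iff `a, b ∈ S` and there is an `E`-path from `a` to
`b` all of whose intermediate vertices lie outside `S`), then for `a, b ∈ S` there is a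
directed `E`-path from `a` to `b` iff there is a directed `E'`-path from `a` to `b`. -/
theorem latent_projection_preserves_transGen {V : Type*}
    (E : V → V → Prop) (S : Set V) (E' : V → V → Prop)
    (hE' : ∀ a b : V, E' a b ↔
      a ∈ S ∧ b ∈ S ∧ ∃ (n : ℕ) (v : ℕ → V), 1 ≤ n ∧ v 0 = a ∧ v n = b ∧
        (∀ l < n, E (v l) (v (l + 1))) ∧ (∀ l, 0 < l → l < n → v l ∉ S)) :
    ∀ a b : V, a ∈ S → b ∈ S →
      (Relation.TransGen E a b ↔ Relation.TransGen E' a b) := by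
  intro a b ha hb
  constructor
  · intro h
    have hE (x) (hx : x ∈ S) (y) (hy : y ∈ S) (hxy : HasPathAvoiding E S x y) : E' x y :=
      (hE' x y).2 ⟨hx, hy, hxy⟩
    obtain ⟨s, hs, has, hsb⟩ := HasPathAvoiding.exists_of_transGen hE ha h
    exact .tail' has (hE s hs b hb hsb)
  · intro h
    induction h with
    | single h => exact HasPathAvoiding.transGen ((hE' _ _).1 h).2.2
    | tail _ h ih =>
      obtain ⟨hx, -, hp⟩ := (hE' _ _).1 h
      exact (ih hx).trans (HasPathAvoiding.transGen hp)
end
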